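/- arXiv:1109.0694 — 2 statements merged into one kernel-verified Lean document; each statement's English description precedes it below -/
import Mathlib

section
/- Tadfaces are not allowed by colorability: let (V, α) be a colorable GFT graph and let d be an internal dart. If α d lies in the same orbit of the face permutation φ = σ ∘ α as d, then that orbit contains at least one external dart. In particular, if (V, α) is closed (α has no fixed points), then for every dart d, the darts d and α d lie in distinct φ-orbits, i.e. no face traverses any edge twice. -/
open Function

/-- The darts of a GFT graph over the vertex set `V`: each vertex carries four corners. -/
abbrev Dart (V : Type*) := V × ZMod 4

/-- A dart is external when it is fixed by the involution `α`. -/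
def IsExternal {V : Type*} (α : Dart V → Dart V) (d : Dart V) : Prop := α d = d

/-- The vertex rotation `σ (v, i) = (v, i + 1)`. -/
def vertexRot {V : Type*} (d : Dart V) : Dart V := (d.1, d.2 + 1)

/-- The face permutation `φ = σ ∘ α`. -/
def facePerm {V : Type*} (α : Dart V → Dart V) (d : Dart V) : Dart V := vertexRot (α d)

/-- Two darts lie on the same face, i.e. the same orbit of the face permutation `φ = σ ∘ α`. -/
def SameFace {V : Type*} (α : Dart V → Dart V) (d d' : Dart V) : Prop :=
  ∃ n : ℕ, (facePerm α)^[n] d = d'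

/-- A multi-orientation of the GFT graph `(V, α)`. -/
def IsMultiOrientation {V : Type*} (α : Dart V → Dart V) (t : Dart V → ZMod 2) : Prop :=
  (∀ (v : V) (i : ZMod 4), t (v, i + 1) = t (v, i) + 1) ∧
  (∀ d : Dart V, α d ≠ d → t (α d) = t d + 1)

/-- A GFT graph is multi-orientable if it admits a multi-orientation. -/
def MultiOrientable {V : Type*} (α : Dart V → Dart V) : Prop :=
  ∃ t : Dart V → ZMod 2, IsMultiOrientation α t

/-- A coloring of the GFT graph `(V, α)`. -/
def IsColoring {V : Type*} (α : Dart V → Dart V) (ε : V → ZMod 2) (c : Dart V → ZMod 4) : Prop :=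
  (∀ (v : V) (i : ZMod 4), ε v = 0 → c (v, i + 1) = c (v, i) + 1) ∧
  (∀ (v : V) (i : ZMod 4), ε v = 1 → c (v, i + 1) = c (v, i) - 1) ∧
  (∀ d : Dart V, α d ≠ d → c (α d) = c d ∧ ε (α d).1 = ε d.1 + 1)

/-- A GFT graph is colorable if it admits a coloring. -/
def Colorable {V : Type*} (α : Dart V → Dart V) : Prop :=
  ∃ (ε : V → ZMod 2) (c : Dart V → ZMod 4), IsColoring α ε c

/-- Reducing the colors modulo two and twisting by the vertex parity gives a multi-orientation. -/
theorem IsColoring.isMultiOrientation {V : Type*} {α : Dart V → Dart V} {ε : V → ZMod 2}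
    {c : Dart V → ZMod 4} (h : IsColoring α ε c) :
    IsMultiOrientation α
      fun d => ZMod.castHom (show 2 ∣ 4 by norm_num) (ZMod 2) (c d) + ε d.1 := by
  obtain ⟨h₀, h₁, hedge⟩ := h
  refine ⟨fun v i => ?_, fun d hd => ?_⟩
  · have hε : ∀ x : ZMod 2, x = 0 ∨ x = 1 := by decide
    rcases hε (ε v) with hv | hv
    · simp only [h₀ v i hv, map_add, map_one]
      ring
    · simp only [h₁ v i hv, map_sub, map_one, CharTwo.sub_eq_add]
      ring
  · obtain ⟨hc, hv⟩ := hedge d hd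
    simp only [hc, hv]
    ring

theorem Colorable.multiOrientable {V : Type*} {α : Dart V → Dart V} (h : Colorable α) :
    MultiOrientable α :=
  let ⟨_, _, hc⟩ := h
  ⟨_, hc.isMultiOrientation⟩

/-- A multi-orientation is preserved when the face permutation crosses an internal edge. -/
theorem IsMultiOrientation.apply_facePerm {V : Type*} {α : Dart V → Dart V} {t : Dart V → ZMod 2}
    (ht : IsMultiOrientation α t) {d : Dart V} (hd : α d ≠ d) :
    t (facePerm α d) = t d := by
  have h : t (facePerm α d) = t (α d) + 1 := ht.1 _ _
  rw [h, ht.2 d hd, add_assoc, CharTwo.add_self_eq_zero, add_zero]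

/-- A multi-orientation is constant along a face without external darts. -/
theorem IsMultiOrientation.eq_of_sameFace {V : Type*} {α : Dart V → Dart V} {t : Dart V → ZMod 2}
    (ht : IsMultiOrientation α t) {d d' : Dart V} (hint : ∀ e, SameFace α d e → ¬ IsExternal α e)
    (h : SameFace α d d') : t d' = t d := by
  obtain ⟨n, rfl⟩ := h
  induction n with
  | zero => rfl
  | succ n ih =>
    rw [Function.iterate_succ_apply', ht.apply_facePerm (hint _ ⟨n, rfl⟩), ih]

/-- Corollary 3.1: tadfaces are not allowed by colorability.  If the face through an
internal dart `d` also traverses `α d`, then that face contains an external dart; in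
particular a closed colorable graph has no tadface. -/
theorem no_tadface_of_colorable {V : Type*} [Fintype V]
    (α : Dart V → Dart V) (hα : Function.Involutive α)
    (hcol : Colorable α) :
    (∀ d : Dart V, α d ≠ d → SameFace α d (α d) →
      ∃ e : Dart V, SameFace α d e ∧ IsExternal α e) ∧
    ((∀ d : Dart V, α d ≠ d) → ∀ d : Dart V, ¬ SameFace α d (α d)) := by
  have hface : ∀ d : Dart V, α d ≠ d → SameFace α d (α d) →
      ∃ e : Dart V, SameFace α d e ∧ IsExternal α e := by
    intro d hd hs
    by_contra! hint
    obtain ⟨t, ht⟩ := hcol.multiOrientable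
    have h := ht.eq_of_sameFace hint hs
    rw [ht.2 d hd] at h
    exact one_ne_zero (add_eq_left.mp h)
  refine ⟨hface, fun hclosed d hs => ?_⟩
  obtain ⟨e, -, he⟩ := hface d (hclosed d) hs
  exact hclosed e he
end

section
/- ``Non-planar'' generalized tadpoles are not allowed by multi-orientability: if (V, α) is a multi-orientable GFT graph with exactly two external darts, then the two external darts lie in the same orbit of the face permutation φ = σ ∘ α (i.e. a multi-orientable two-point graph has exactly one broken face; it cannot have its two external edges breaking two distinct faces). -/
open Function

theorem vertexRot_injective {V : Type*} : Injective (vertexRot : Dart V → Dart V) := by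
  rintro ⟨v, i⟩ ⟨w, j⟩ h
  simpa [vertexRot] using h

theorem facePerm_injective {V : Type*} {α : Dart V → Dart V} (hα : Injective α) :
    Injective (facePerm α) :=
  vertexRot_injective.comp hα

theorem IsMultiOrientation.facePerm_of_isExternal {V : Type*} {α : Dart V → Dart V}
    {t : Dart V → ZMod 2} (ht : IsMultiOrientation α t) {d : Dart V} (hd : IsExternal α d) :
    t (facePerm α d) = t d + 1 := by
  rw [facePerm, hd]
  exact ht.1 d.1 d.2

theorem IsMultiOrientation.facePerm_of_not_isExternal {V : Type*} {α : Dart V → Dart V}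
    {t : Dart V → ZMod 2} (ht : IsMultiOrientation α t) {d : Dart V} (hd : ¬ IsExternal α d) :
    t (facePerm α d) = t d := by
  have h : t (facePerm α d) = t (α d) + 1 := ht.1 (α d).1 (α d).2
  rw [h, ht.2 d hd, add_assoc, CharTwo.add_self_eq_zero, add_zero]

/-- In a multi-orientable graph no face is broken by exactly one external dart. -/
theorem IsMultiOrientation.exists_ne_isExternal_sameFace {V : Type*} [Finite V]
    {α : Dart V → Dart V} (hα : Injective α) {t : Dart V → ZMod 2}
    (ht : IsMultiOrientation α t) {d : Dart V} (hd : IsExternal α d) :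
    ∃ e, e ≠ d ∧ IsExternal α e ∧ SameFace α d e := by
  by_contra! hno
  have hpos : 0 < minimalPeriod (facePerm α) d :=
    minimalPeriod_pos_of_mem_periodicPts ((facePerm_injective hα).mem_periodicPts d)
  have hconst : ∀ k, 1 ≤ k → k ≤ minimalPeriod (facePerm α) d →
      t ((facePerm α)^[k] d) = t d + 1 := by
    intro k hk
    induction k, hk using Nat.le_induction with
    | base => exact fun _ => ht.facePerm_of_isExternal hd
    | succ k hk ih =>
      intro hlt
      have hreturn : (facePerm α)^[k] d ≠ d :=
        not_isPeriodicPt_of_pos_of_lt_minimalPeriod (by omega) hlt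
      rw [iterate_succ_apply', ht.facePerm_of_not_isExternal fun h => hno _ hreturn h ⟨k, rfl⟩]
      exact ih (by omega)
  have hperiod := hconst _ hpos le_rfl
  rw [iterate_minimalPeriod] at hperiod
  exact one_ne_zero (left_eq_add.mp hperiod)

/-- Corollary 3.2: "non-planar" generalized tadpoles are not allowed by
multi-orientability.  In a multi-orientable GFT graph with exactly two external darts,
the two external darts lie on the same face. -/
theorem two_point_one_broken_face_of_multiOrientable {V : Type*} [Fintype V]
    (α : Dart V → Dart V) (hα : Function.Involutive α)
    (hmo : MultiOrientable α)
    (d₁ d₂ : Dart V) (h₁ : IsExternal α d₁) (h₂ : IsExternal α d₂) (hne : d₁ ≠ d₂)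
    (hall : ∀ d : Dart V, IsExternal α d → d = d₁ ∨ d = d₂) :
    SameFace α d₁ d₂ := by
  obtain ⟨t, ht⟩ := hmo
  obtain ⟨e, hne', he, hface⟩ := ht.exists_ne_isExternal_sameFace hα.injective h₁
  obtain rfl := (hall e he).resolve_left hne'
  exact hface
end
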